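/- arXiv:2007.12895 — 4 statements merged into one kernel-verified Lean document; each statement's English description precedes it below -/
import Mathlib

section
/- Let ℓ > 0, R > 0, set φ_ℓ(τ) = τ^{ℓ+1}/(ℓ+1) and γ = ℓ/(2(ℓ+1)). Fix z ≥ R and t > 0 with φ_ℓ(t) = z + R. Then for every y ∈ [R, z] and every b > 0 with φ_ℓ(b) ∈ [y − R, y + R], the kernel satisfies E(t,z;b,y;ℓ) ≥ 2^{−2γ} (y+R)^{−γ} (z+R)^{−γ}. -/
open Real

/-- Rising factorial (Pochhammer symbol) `(a)_k = a(a+1)⋯(a+k−1)`. -/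
noncomputable def risingFactorial (a : ℝ) (k : ℕ) : ℝ :=
  ∏ i ∈ Finset.range k, (a + i)

/-- Gauss hypergeometric function `F(a,b;c;z) = ∑ (a)_k (b)_k / ((c)_k k!) z^k`. -/
noncomputable def hyperF (a b c z : ℝ) : ℝ :=
  ∑' k : ℕ, (risingFactorial a k * risingFactorial b k) /
      (risingFactorial c k * (Nat.factorial k : ℝ)) * z ^ k

/-- The distance function `φ_ℓ(τ) = τ^{ℓ+1}/(ℓ+1)`. -/
noncomputable def phiL (ℓ τ : ℝ) : ℝ := τ ^ (ℓ + 1) / (ℓ + 1)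

/-- The parameter `γ = ℓ/(2(ℓ+1))`. -/
noncomputable def gamL (ℓ : ℝ) : ℝ := ℓ / (2 * (ℓ + 1))

/-- Yagdjian's kernel. -/
noncomputable def kernelE (ℓ t x b y : ℝ) : ℝ :=
  ((phiL ℓ t + phiL ℓ b) ^ 2 - (y - x) ^ 2) ^ (-(gamL ℓ)) *
    hyperF (gamL ℓ) (gamL ℓ) 1
      (((phiL ℓ t - phiL ℓ b) ^ 2 - (y - x) ^ 2) /
        ((phiL ℓ t + phiL ℓ b) ^ 2 - (y - x) ^ 2))

theorem risingFactorial_nonneg {a : ℝ} (ha : 0 ≤ a) (k : ℕ) : 0 ≤ risingFactorial a k :=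
  Finset.prod_nonneg fun _ _ => by positivity

theorem risingFactorial_le_risingFactorial {a b : ℝ} (ha : 0 ≤ a) (hab : a ≤ b) (k : ℕ) :
    risingFactorial a k ≤ risingFactorial b k :=
  Finset.prod_le_prod (fun _ _ => by positivity) fun _ _ => by gcongr

theorem risingFactorial_one (k : ℕ) : risingFactorial 1 k = (k.factorial : ℝ) := by
  rw [risingFactorial, ← Finset.prod_range_add_one_eq_factorial]
  push_cast
  exact Finset.prod_congr rfl fun _ _ => add_comm _ _

/-- For parameters `a, b ∈ [0, 1]` and argument in `[0, 1)`, the series `F(a, b; 1; x)` has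
nonnegative terms dominated by the geometric series, hence is at least its first term. -/
theorem one_le_hyperF_one {a b x : ℝ} (ha : 0 ≤ a) (ha' : a ≤ 1) (hb : 0 ≤ b) (hb' : b ≤ 1)
    (hx : 0 ≤ x) (hx' : x < 1) : 1 ≤ hyperF a b 1 x := by
  have hnonneg : ∀ k : ℕ, 0 ≤ (risingFactorial a k * risingFactorial b k) /
      (risingFactorial 1 k * (Nat.factorial k : ℝ)) * x ^ k := fun k => by
    have h1 := risingFactorial_nonneg ha k
    have h2 := risingFactorial_nonneg hb k
    have h3 := risingFactorial_nonneg zero_le_one k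
    positivity
  have hsummable : Summable fun k : ℕ => (risingFactorial a k * risingFactorial b k) /
      (risingFactorial 1 k * (Nat.factorial k : ℝ)) * x ^ k := by
    refine Summable.of_nonneg_of_le hnonneg (fun k => ?_) (summable_geometric_of_lt_one hx hx')
    refine mul_le_of_le_one_left (by positivity) ?_
    have h1 := risingFactorial_le_risingFactorial ha ha' k
    have h2 := risingFactorial_le_risingFactorial hb hb' k
    rw [risingFactorial_one] at h1 h2 ⊢
    exact div_le_one_of_le₀
      (mul_le_mul h1 h2 (risingFactorial_nonneg hb k) (by positivity)) (by positivity)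
  simpa [hyperF, risingFactorial] using hsummable.le_tsum 0 fun k _ => hnonneg k

theorem gamL_nonneg {ℓ : ℝ} (hℓ : 0 ≤ ℓ) : 0 ≤ gamL ℓ := by
  unfold gamL
  positivity

theorem gamL_le_one {ℓ : ℝ} (hℓ : 0 ≤ ℓ) : gamL ℓ ≤ 1 :=
  div_le_one_of_le₀ (by linarith) (by positivity)

theorem phiL_pos {ℓ τ : ℝ} (hℓ : 0 ≤ ℓ) (hτ : 0 < τ) : 0 < phiL ℓ τ := by
  unfold phiL
  positivity

/-- Inside the backward light cone of `(t, x)`, the kernel is bounded below by its power factor. -/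
theorem rpow_le_kernelE {ℓ t x b y : ℝ} (hℓ : 0 ≤ ℓ) (ht : 0 < t) (hb : 0 < b)
    (hcone : |y - x| ≤ phiL ℓ t - phiL ℓ b) :
    ((phiL ℓ t + phiL ℓ b) ^ 2 - (y - x) ^ 2) ^ (-(gamL ℓ)) ≤ kernelE ℓ t x b y := by
  have hT := phiL_pos hℓ ht
  have hB := phiL_pos hℓ hb
  have hN : 0 ≤ (phiL ℓ t - phiL ℓ b) ^ 2 - (y - x) ^ 2 :=
    sub_nonneg.2 (sq_le_sq.2 (hcone.trans (le_abs_self _)))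
  have hND : (phiL ℓ t - phiL ℓ b) ^ 2 - (y - x) ^ 2
      < (phiL ℓ t + phiL ℓ b) ^ 2 - (y - x) ^ 2 := by
    nlinarith [mul_pos hT hB]
  have hD := hN.trans_lt hND
  exact le_mul_of_one_le_right (rpow_nonneg hD.le _)
    (one_le_hyperF_one (gamL_nonneg hℓ) (gamL_le_one hℓ) (gamL_nonneg hℓ) (gamL_le_one hℓ)
      (div_nonneg hN hD.le) ((div_lt_one hD).2 hND))

/-- On the characteristic line `φ_ℓ(t) = z + R` with `z ≥ R`, for `y ∈ [R,z]` and
`φ_ℓ(b) ∈ [y−R, y+R]` the kernel satisfies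
`E(t,z;b,y;ℓ) ≥ 2^{−2γ}(y+R)^{−γ}(z+R)^{−γ}`. -/
theorem kernelE_lower_bound_on_characteristic (ℓ R : ℝ) (hℓ : 0 < ℓ) (hR : 0 < R)
    (z t : ℝ) (hz : R ≤ z) (ht : 0 < t) (hchar : phiL ℓ t = z + R)
    (y b : ℝ) (hy : y ∈ Set.Icc R z) (hb : 0 < b)
    (hphib : phiL ℓ b ∈ Set.Icc (y - R) (y + R)) :
    (2 : ℝ) ^ (-(2 * gamL ℓ)) * (y + R) ^ (-(gamL ℓ)) * (z + R) ^ (-(gamL ℓ))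
      ≤ kernelE ℓ t z b y := by
  obtain ⟨hRy, hyz⟩ := hy
  obtain ⟨hBl, hBu⟩ := hphib
  have hB := phiL_pos hℓ.le hb
  have hcone : |y - z| ≤ phiL ℓ t - phiL ℓ b := by
    rw [abs_of_nonpos (by linarith)]
    linarith
  refine le_trans ?_ (rpow_le_kernelE hℓ.le ht hb hcone)
  have hD : 0 < (phiL ℓ t + phiL ℓ b) ^ 2 - (y - z) ^ 2 := by
    rw [hchar, sq_sub_sq]
    exact mul_pos (by linarith) (by linarith)
  have hDu : (phiL ℓ t + phiL ℓ b) ^ 2 - (y - z) ^ 2 ≤ 4 * (y + R) * (z + R) := by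
    have hsq : (phiL ℓ t + phiL ℓ b) ^ 2 ≤ (z + y + 2 * R) ^ 2 :=
      pow_le_pow_left₀ (by linarith) (by linarith) 2
    linarith
  have hfour : (2 : ℝ) ^ (-(2 * gamL ℓ)) = 4 ^ (-(gamL ℓ)) := by
    rw [← mul_neg, rpow_mul zero_le_two]
    norm_num
  rw [hfour, ← mul_rpow (by norm_num) (by linarith),
    ← mul_rpow (mul_nonneg (by norm_num) (by linarith)) (by linarith)]
  exact rpow_le_rpow_of_nonpos hD hDu (neg_nonpos.2 (gamL_nonneg hℓ.le))
end

section
/- Let ℓ > 0, R > 0, γ = ℓ/(2(ℓ+1)), φ_ℓ(τ) = τ^{ℓ+1}/(ℓ+1), and let a_ℓ = 2^{1−2γ} Γ(2γ)/Γ(γ)², b_ℓ = 2^{2γ−1}(ℓ+1)^{1−2γ} Γ(2−2γ)/Γ(1−γ)². Set K = min{2^{2(γ−1)} a_ℓ R^{γ−1}, 2^{−2γ} b_ℓ R^{−γ}}. Let 𝒰₀, 𝒰₁ : ℝ → ℝ be nonnegative integrable functions supported in (−R, R). Then for every z ≥ R and t > 0 with φ_ℓ(t) = z + R, the quantity J(t,z)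 = φ_ℓ(t)^{−γ} ∫_{z−φ_ℓ(t)}^{z+φ_ℓ(t)} ( 2^{γ−1} a_ℓ 𝒰₀(y) (φ_ℓ(t) − z + y)^{γ−1} + 2^{−γ} b_ℓ 𝒰₁(y) (φ_ℓ(t) − z + y)^{−γ} ) dy satisfies J(t,z) ≥ K (z+R)^{−γ} ∫_ℝ (𝒰₀(y) + 𝒰₁(y)) dy. -/
open Real MeasureTheory intervalIntegral

/-- The constant `a_ℓ = 2^{1−2γ} Γ(2γ)/Γ(γ)²`. -/
noncomputable def aL (ℓ : ℝ) : ℝ :=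
  (2 : ℝ) ^ (1 - 2 * gamL ℓ) * Real.Gamma (2 * gamL ℓ) / (Real.Gamma (gamL ℓ)) ^ 2

/-- The constant `b_ℓ = 2^{2γ−1}(ℓ+1)^{1−2γ} Γ(2−2γ)/Γ(1−γ)²`. -/
noncomputable def bL (ℓ : ℝ) : ℝ :=
  (2 : ℝ) ^ (2 * gamL ℓ - 1) * (ℓ + 1) ^ (1 - 2 * gamL ℓ) *
    Real.Gamma (2 - 2 * gamL ℓ) / (Real.Gamma (1 - gamL ℓ)) ^ 2

lemma gamL_pos {ℓ : ℝ} (hℓ : 0 < ℓ) : 0 < gamL ℓ := by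
  unfold gamL
  positivity

lemma gamL_lt_one {ℓ : ℝ} (hℓ : 0 < ℓ) : gamL ℓ < 1 := by
  unfold gamL
  rw [div_lt_one (by positivity)]
  linarith

lemma aL_nonneg {ℓ : ℝ} (hℓ : 0 < ℓ) : 0 ≤ aL ℓ := by
  have h := Real.Gamma_pos_of_pos (mul_pos two_pos (gamL_pos hℓ))
  unfold aL
  positivity

lemma bL_nonneg {ℓ : ℝ} (hℓ : 0 < ℓ) : 0 ≤ bL ℓ := by
  have h : 0 < Real.Gamma (2 - 2 * gamL ℓ) :=
    Real.Gamma_pos_of_pos (by linarith [gamL_lt_one hℓ])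
  unfold bL
  positivity

lemma weighted_lower_bound {p c u x R : ℝ} (hp : p ≤ 0) (hc : 0 ≤ c) (hu : 0 ≤ u)
    (hR : 0 < R) (hx : 0 < x) (hxR : x ≤ 2 * R) :
    (2 : ℝ) ^ (2 * p) * c * R ^ p * u ≤ (2 : ℝ) ^ p * c * u * x ^ p := by
  have hpow : (2 * R) ^ p ≤ x ^ p := Real.rpow_le_rpow_of_nonpos hx hxR hp
  calc (2 : ℝ) ^ (2 * p) * c * R ^ p * u = (2 : ℝ) ^ p * c * u * (2 * R) ^ p := by
        rw [two_mul p, Real.rpow_add two_pos, Real.mul_rpow two_pos.le hR.le]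
        ring
    _ ≤ (2 : ℝ) ^ p * c * u * x ^ p := by gcongr

/-- Lower bound for the linear part `J(t,z)` on the characteristic line `φ_ℓ(t) = z + R`,
`z ≥ R`, in terms of `K (z+R)^{−γ} ∫ (𝒰₀ + 𝒰₁)` with
`K = min{2^{2(γ−1)} a_ℓ R^{γ−1}, 2^{−2γ} b_ℓ R^{−γ}}`. -/
theorem linear_part_lower_bound (ℓ R : ℝ) (hℓ : 0 < ℓ) (hR : 0 < R)
    (𝒰₀ 𝒰₁ : ℝ → ℝ)
    (h𝒰₀nonneg : ∀ y, 0 ≤ 𝒰₀ y) (h𝒰₁nonneg : ∀ y, 0 ≤ 𝒰₁ y)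
    (h𝒰₀int : Integrable 𝒰₀) (h𝒰₁int : Integrable 𝒰₁)
    (h𝒰₀supp : ∀ y, y ∉ Set.Ioo (-R) R → 𝒰₀ y = 0)
    (h𝒰₁supp : ∀ y, y ∉ Set.Ioo (-R) R → 𝒰₁ y = 0)
    (z t : ℝ) (hz : R ≤ z) (ht : 0 < t) (hchar : phiL ℓ t = z + R)
    (hInt : IntervalIntegrable
      (fun y => (2 : ℝ) ^ (gamL ℓ - 1) * aL ℓ * 𝒰₀ y * (phiL ℓ t - z + y) ^ (gamL ℓ - 1)
        + (2 : ℝ) ^ (-(gamL ℓ)) * bL ℓ * 𝒰₁ y * (phiL ℓ t - z + y) ^ (-(gamL ℓ)))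
      volume (z - phiL ℓ t) (z + phiL ℓ t)) :
    min ((2 : ℝ) ^ (2 * (gamL ℓ - 1)) * aL ℓ * R ^ (gamL ℓ - 1))
        ((2 : ℝ) ^ (-(2 * gamL ℓ)) * bL ℓ * R ^ (-(gamL ℓ))) *
      (z + R) ^ (-(gamL ℓ)) * (∫ y, (𝒰₀ y + 𝒰₁ y)) ≤
    (phiL ℓ t) ^ (-(gamL ℓ)) *
      ∫ y in (z - phiL ℓ t)..(z + phiL ℓ t),
        ((2 : ℝ) ^ (gamL ℓ - 1) * aL ℓ * 𝒰₀ y * (phiL ℓ t - z + y) ^ (gamL ℓ - 1)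
          + (2 : ℝ) ^ (-(gamL ℓ)) * bL ℓ * 𝒰₁ y * (phiL ℓ t - z + y) ^ (-(gamL ℓ))) := by
  rw [hchar] at hInt ⊢
  have hlow : z - (z + R) = -R := by ring
  have hw : z + R - z = R := by ring
  rw [hlow] at hInt ⊢
  simp only [hw] at hInt ⊢
  have hle : -R ≤ z + (z + R) := by linarith
  have hγ := gamL_pos hℓ
  have hγ' := gamL_lt_one hℓ
  set K := min ((2 : ℝ) ^ (2 * (gamL ℓ - 1)) * aL ℓ * R ^ (gamL ℓ - 1))
    ((2 : ℝ) ^ (-(2 * gamL ℓ)) * bL ℓ * R ^ (-(gamL ℓ)))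
  have hrestrict : ∫ y, (𝒰₀ y + 𝒰₁ y) = ∫ y in (-R)..(z + (z + R)), (𝒰₀ y + 𝒰₁ y) := by
    rw [intervalIntegral.integral_of_le hle,
      setIntegral_eq_integral_of_forall_compl_eq_zero]
    intro y hy
    have hy' : y ∉ Set.Ioo (-R) R := fun h => hy ⟨h.1, by linarith [h.2]⟩
    rw [h𝒰₀supp y hy', h𝒰₁supp y hy', add_zero]
  rw [mul_comm K, mul_assoc, hrestrict, ← intervalIntegral.integral_const_mul]
  refine mul_le_mul_of_nonneg_left ?_ (Real.rpow_nonneg (by linarith) _)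
  refine intervalIntegral.integral_mono_on hle
    ((h𝒰₀int.add h𝒰₁int).const_mul K).intervalIntegrable hInt fun y _ => ?_
  by_cases hy : y ∈ Set.Ioo (-R) R
  · have hpos : 0 < R + y := by linarith [hy.1]
    have hupper : R + y ≤ 2 * R := by linarith [hy.2]
    have h₀ := weighted_lower_bound (p := gamL ℓ - 1) (by linarith) (aL_nonneg hℓ)
      (h𝒰₀nonneg y) hR hpos hupper
    have h₁ := weighted_lower_bound (p := -gamL ℓ) (by linarith) (bL_nonneg hℓ)
      (h𝒰₁nonneg y) hR hpos hupper
    rw [mul_neg] at h₁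
    rw [mul_add]
    exact add_le_add
      ((mul_le_mul_of_nonneg_right (min_le_left _ _) (h𝒰₀nonneg y)).trans h₀)
      ((mul_le_mul_of_nonneg_right (min_le_right _ _) (h𝒰₁nonneg y)).trans h₁)
  · simp [h𝒰₀supp y hy, h𝒰₁supp y hy]
end

section
/- Let p > 1, C > 0, R > 0, A > 0, and Z > R. Suppose G : [R, Z] → ℝ is differentiable, G(R) = A, G(z) > 0 for all z ∈ [R, Z], and G'(z) ≥ C (R+z)^{−1} G(z)^p for all z ∈ [R, Z]. Then A^{1−p} − G(Z)^{1−p} ≥ C (p−1) log((R+Z)/(2R)); in particular A^{1−p} > C (p−1) log((R+Z)/(2R)), so that Z < 2R · exp( A^{1−p} / (C(p−1)) ) − R. -/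
open Real Set

/-- If `G > 0` satisfies `C (R+z)⁻¹ G(z)^p ≤ G'(z)` on `[R, Z]`, then
`G(z)^(1-p) + C (p-1) log (R+z)` is nonincreasing there. -/
theorem antitoneOn_rpow_add_log {p C R Z : ℝ} {G : ℝ → ℝ} (hp : 1 < p) (hR : 0 < R)
    (hGpos : ∀ z ∈ Set.Icc R Z, 0 < G z)
    (hGdiff : ∀ z ∈ Set.Icc R Z, DifferentiableAt ℝ G z)
    (hGineq : ∀ z ∈ Set.Icc R Z, C * (R + z)⁻¹ * G z ^ p ≤ deriv G z) :
    AntitoneOn (fun z => G z ^ (1 - p) + C * (p - 1) * Real.log (R + z)) (Set.Icc R Z) := by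
  have hderiv : ∀ z ∈ Set.Icc R Z,
      HasDerivAt (fun z => G z ^ (1 - p) + C * (p - 1) * Real.log (R + z))
        (deriv G z * (1 - p) * G z ^ (1 - p - 1) + C * (p - 1) * (1 / (R + z))) z := by
    intro z hz
    have hRz : R + z ≠ 0 := by linarith [hz.1]
    exact ((hGdiff z hz).hasDerivAt.rpow_const (Or.inl (hGpos z hz).ne')).add
      ((((hasDerivAt_id z).const_add R).log hRz).const_mul _)
  refine antitoneOn_of_hasDerivWithinAt_nonpos (convex_Icc R Z)
    (fun z hz => (hderiv z hz).continuousAt.continuousWithinAt)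
    (fun z hz => (hderiv z (interior_subset hz)).hasDerivWithinAt) fun z hz => ?_
  have hz := interior_subset hz
  have hmul : C * (R + z)⁻¹ ≤ deriv G z * G z ^ (-p) := by
    have h := mul_le_mul_of_nonneg_right (hGineq z hz)
      (Real.rpow_nonneg (hGpos z hz).le (-p))
    rwa [mul_assoc, ← Real.rpow_add (hGpos z hz), add_neg_cancel, Real.rpow_zero,
      mul_one] at h
  rw [show 1 - p - 1 = -p by ring, one_div]
  nlinarith [mul_le_mul_of_nonneg_left hmul (sub_pos.2 hp).le]

/-- Critical-case comparison lemma for the Riccati-type differential inequality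
`G'(z) ≥ C (R+z)^{−1} G(z)^p` on `[R,Z]` with `G(R) = A > 0`:
`A^{1−p} − G(Z)^{1−p} ≥ C(p−1) log((R+Z)/(2R))`, hence
`A^{1−p} > C(p−1) log((R+Z)/(2R))` and `Z < 2R exp(A^{1−p}/(C(p−1))) − R`. -/
theorem comparison_critical (p C R A Z : ℝ) (hp : 1 < p) (hC : 0 < C) (hR : 0 < R)
    (hA : 0 < A) (hZ : R < Z) (G : ℝ → ℝ)
    (hGR : G R = A)
    (hGpos : ∀ z ∈ Set.Icc R Z, 0 < G z)
    (hGdiff : ∀ z ∈ Set.Icc R Z, DifferentiableAt ℝ G z)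
    (hGineq : ∀ z ∈ Set.Icc R Z, C * (R + z)⁻¹ * G z ^ p ≤ deriv G z) :
    C * (p - 1) * Real.log ((R + Z) / (2 * R)) ≤ A ^ (1 - p) - G Z ^ (1 - p) ∧
      C * (p - 1) * Real.log ((R + Z) / (2 * R)) < A ^ (1 - p) ∧
      Z < 2 * R * Real.exp (A ^ (1 - p) / (C * (p - 1))) - R := by
  have key : C * (p - 1) * Real.log ((R + Z) / (2 * R)) ≤ A ^ (1 - p) - G Z ^ (1 - p) := by
    have h := antitoneOn_rpow_add_log hp hR hGpos hGdiff hGineq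
      (left_mem_Icc.2 hZ.le) (right_mem_Icc.2 hZ.le) hZ.le
    rw [Real.log_div (by linarith) (by linarith), two_mul R, ← hGR]
    simp only at h
    linarith
  have hlt : C * (p - 1) * Real.log ((R + Z) / (2 * R)) < A ^ (1 - p) := by
    have := Real.rpow_pos_of_pos (hGpos Z (right_mem_Icc.2 hZ.le)) (1 - p)
    linarith
  refine ⟨key, hlt, ?_⟩
  have hCp : 0 < C * (p - 1) := mul_pos hC (sub_pos.2 hp)
  have hlog : Real.log ((R + Z) / (2 * R)) < A ^ (1 - p) / (C * (p - 1)) := by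
    rwa [lt_div_iff₀' hCp]
  rw [Real.log_lt_iff_lt_exp (div_pos (by linarith) (by linarith)), div_lt_iff₀' (by linarith)] at hlog
  linarith
end

section
/- Let p > 1, C > 0, R > 0, A > 0, α ∈ (0,1), and Z > R. Suppose G : [R, Z] → ℝ is differentiable, G(R) = A, G(z) > 0 for all z ∈ [R, Z], and G'(z) ≥ C (R+z)^{−α} G(z)^p for all z ∈ [R, Z]. Then A^{1−p} − G(Z)^{1−p} ≥ (C(p−1)/(1−α)) ( (R+Z)^{1−α} − (2R)^{1−α} ); in particular A^{1−p} > (C(p−1)/(1−α)) ( (R+Z)^{1−α} − (2R)^{1−α} ), so that R + Z < ( (2R)^{1−α} + (1−α) A^{1−p} / (C(p−1)) )^{1/(1−α)}. -/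
open Real Set

/-- Subcritical-case comparison lemma for the Riccati-type differential inequality
`G'(z) ≥ C (R+z)^{−α} G(z)^p` on `[R,Z]`, `α ∈ (0,1)`, with `G(R) = A > 0`:
`A^{1−p} − G(Z)^{1−p} ≥ (C(p−1)/(1−α))((R+Z)^{1−α} − (2R)^{1−α})`, hence
`A^{1−p} > (C(p−1)/(1−α))((R+Z)^{1−α} − (2R)^{1−α})` and
`R + Z < ((2R)^{1−α} + (1−α)A^{1−p}/(C(p−1)))^{1/(1−α)}`. -/
theorem comparison_subcritical (p C R A α Z : ℝ) (hp : 1 < p) (hC : 0 < C) (hR : 0 < R)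
    (hA : 0 < A) (hα0 : 0 < α) (hα1 : α < 1) (hZ : R < Z) (G : ℝ → ℝ)
    (hGR : G R = A)
    (hGpos : ∀ z ∈ Set.Icc R Z, 0 < G z)
    (hGdiff : ∀ z ∈ Set.Icc R Z, DifferentiableAt ℝ G z)
    (hGineq : ∀ z ∈ Set.Icc R Z, C * (R + z) ^ (-α) * G z ^ p ≤ deriv G z) :
    C * (p - 1) / (1 - α) * ((R + Z) ^ (1 - α) - (2 * R) ^ (1 - α))
        ≤ A ^ (1 - p) - G Z ^ (1 - p) ∧
      C * (p - 1) / (1 - α) * ((R + Z) ^ (1 - α) - (2 * R) ^ (1 - α)) < A ^ (1 - p) ∧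
      R + Z < ((2 * R) ^ (1 - α) + (1 - α) * A ^ (1 - p) / (C * (p - 1))) ^ (1 / (1 - α)) := by
  have hp1 : 0 < p - 1 := sub_pos.2 hp
  have hα : 0 < 1 - α := sub_pos.2 hα1
  have hRZ : 0 < R + Z := by linarith
  have hderiv : ∀ z ∈ Set.Icc R Z, HasDerivAt
      (fun z => G z ^ (1 - p) + C * (p - 1) / (1 - α) * (R + z) ^ (1 - α))
      (deriv G z * (1 - p) * G z ^ (-p) + C * (p - 1) * (R + z) ^ (-α)) z := by
    intro z hz
    have hRz : R + z ≠ 0 := by linarith [hz.1]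
    have hG := (hGdiff z hz).hasDerivAt.rpow_const (p := 1 - p) (Or.inl (hGpos z hz).ne')
    have hz' := (((hasDerivAt_id z).const_add R).rpow_const (p := 1 - α)
      (Or.inl hRz)).const_mul (C * (p - 1) / (1 - α))
    refine (hG.add hz').congr_deriv ?_
    simp only [id_eq, sub_sub_cancel_left]
    field_simp
  have hanti : AntitoneOn
      (fun z => G z ^ (1 - p) + C * (p - 1) / (1 - α) * (R + z) ^ (1 - α)) (Set.Icc R Z) := by
    refine antitoneOn_of_deriv_nonpos (convex_Icc R Z)
      (fun z hz => (hderiv z hz).continuousAt.continuousWithinAt)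
      (fun z hz => (hderiv z (interior_subset hz)).differentiableAt.differentiableWithinAt)
      fun z hz => ?_
    replace hz := interior_subset hz
    rw [(hderiv z hz).deriv]
    have hGp : G z ^ p * G z ^ (-p) = 1 := by
      rw [← rpow_add (hGpos z hz), add_neg_cancel, rpow_zero]
    have h := mul_le_mul_of_nonneg_right (hGineq z hz) (rpow_nonneg (hGpos z hz).le (-p))
    rw [mul_assoc, hGp, mul_one] at h
    linarith [mul_le_mul_of_nonneg_left h hp1.le]
  have hle : C * (p - 1) / (1 - α) * ((R + Z) ^ (1 - α) - (2 * R) ^ (1 - α))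
      ≤ A ^ (1 - p) - G Z ^ (1 - p) := by
    have h := hanti (left_mem_Icc.2 hZ.le) (right_mem_Icc.2 hZ.le) hZ.le
    simp only [hGR, ← two_mul] at h
    linarith
  have hlt : C * (p - 1) / (1 - α) * ((R + Z) ^ (1 - α) - (2 * R) ^ (1 - α)) < A ^ (1 - p) := by
    linarith [rpow_pos_of_pos (hGpos Z (right_mem_Icc.2 hZ.le)) (1 - p)]
  refine ⟨hle, hlt, ?_⟩
  rw [one_div, lt_rpow_inv_iff_of_pos hRZ.le (by positivity) hα, ← sub_lt_iff_lt_add',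
    lt_div_iff₀ (by positivity)]
  rw [div_mul_eq_mul_div, div_lt_iff₀ hα] at hlt
  linarith
end
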